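/- Suppose the field F has more than n−k elements, 1 < k < n−1 and k ≥ 3. If 𝔖 is a special set of stars of Δ_k(V), then there exists a degenerate k-dimensional subspace X of F^n such that 𝔖 consists exactly of the stars S^c(X') over all (k−1)-dimensional subspaces X' contained in X. -/

import Mathlib

open Module

section Defs

variable (F : Type*) [Field F]

/-- The `i`-th coordinate hyperplane in `F^n`: the kernel of the `i`-th coordinate functional. -/
def coordHyp (n : ℕ) (i : Fin n) : Submodule F (Fin n → F) :=
  LinearMap.ker (LinearMap.proj (R := F) (φ := fun _ : Fin n => F) i)

/-- A subspace of `F^n` is degenerate if it is contained in some coordinate hyperplane. -/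
def IsDeg (n : ℕ) (W : Submodule F (Fin n → F)) : Prop :=
  ∃ i : Fin n, W ≤ coordHyp F n i

/-- A subspace of `F^n` is non-degenerate if it is not degenerate. -/
def IsNondeg (n : ℕ) (W : Submodule F (Fin n → F)) : Prop :=
  ¬ IsDeg F n W

/-- Adjacency of `k`-dimensional subspaces: distinct with `(k-1)`-dimensional intersection. -/
def AdjK (n k : ℕ) (A B : Submodule F (Fin n → F)) : Prop :=
  A ≠ B ∧ finrank F ↥(A ⊓ B) = k - 1

/-- The star `S(X)`: all `k`-dimensional subspaces containing `X`. -/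
def Sstar (n k : ℕ) (X : Submodule F (Fin n → F)) : Set (Submodule F (Fin n → F)) :=
  {A | finrank F ↥A = k ∧ X ≤ A}

/-- `S^c(X)`: all non-degenerate `k`-dimensional subspaces containing `X`. -/
def Sc (n k : ℕ) (X : Submodule F (Fin n → F)) : Set (Submodule F (Fin n → F)) :=
  {A | finrank F ↥A = k ∧ X ≤ A ∧ IsNondeg F n A}

/-- `T^c(Y)`: all non-degenerate `k`-dimensional subspaces contained in `Y`. -/
def Tc (n k : ℕ) (Y : Submodule F (Fin n → F)) : Set (Submodule F (Fin n → F)) :=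
  {A | finrank F ↥A = k ∧ A ≤ Y ∧ IsNondeg F n A}

/-- A clique of `Δ_k(V)`: a set of non-degenerate `k`-dimensional subspaces which are
pairwise adjacent. -/
def IsCliqueD (n k : ℕ) (C : Set (Submodule F (Fin n → F))) : Prop :=
  (∀ A ∈ C, finrank F ↥A = k ∧ IsNondeg F n A) ∧
    ∀ A ∈ C, ∀ B ∈ C, A ≠ B → AdjK F n k A B

/-- A maximal clique of `Δ_k(V)`. -/
def IsMaxCliqueD (n k : ℕ) (C : Set (Submodule F (Fin n → F))) : Prop :=
  IsCliqueD F n k C ∧ ∀ D, IsCliqueD F n k D → C ⊆ D → D = C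

/-- A star of `Δ_k(V)`: a set `S^c(X)` which is a maximal clique of `Δ_k(V)`. -/
def IsStarD (n k : ℕ) (S : Set (Submodule F (Fin n → F))) : Prop :=
  (∃ X : Submodule F (Fin n → F), finrank F ↥X = k - 1 ∧ S = Sc F n k X) ∧
    IsMaxCliqueD F n k S

/-- A top of `Δ_k(V)`: a set `T^c(Y)` which is a maximal clique of `Δ_k(V)`. -/
def IsTopD (n k : ℕ) (T : Set (Submodule F (Fin n → F))) : Prop :=
  (∃ Y : Submodule F (Fin n → F), finrank F ↥Y = k + 1 ∧ T = Tc F n k Y) ∧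
    IsMaxCliqueD F n k T

/-- Adjacency of maximal cliques used in the graphs `Δ_s` and `Δ_t`:
two distinct cliques such that every vertex of each is adjacent to some vertex of the other. -/
def AdjMC (n k : ℕ) (C1 C2 : Set (Submodule F (Fin n → F))) : Prop :=
  C1 ≠ C2 ∧ (∀ A ∈ C1, ∃ B ∈ C2, AdjK F n k A B) ∧
    (∀ A ∈ C2, ∃ B ∈ C1, AdjK F n k A B)

/-- Adjacency in the graphs `Δ'_s` and `Δ'_t`: adjacent as above with empty intersection. -/
def AdjMC' (n k : ℕ) (C1 C2 : Set (Submodule F (Fin n → F))) : Prop :=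
  AdjMC F n k C1 C2 ∧ C1 ∩ C2 = ∅

/-- A clique of the graph `Δ_s` (whose vertices are the stars of `Δ_k(V)`). -/
def IsCliqueDs (n k : ℕ) (𝔖 : Set (Set (Submodule F (Fin n → F)))) : Prop :=
  (∀ S ∈ 𝔖, IsStarD F n k S) ∧ ∀ S ∈ 𝔖, ∀ S' ∈ 𝔖, S ≠ S' → AdjMC F n k S S'

/-- A maximal clique of `Δ_s`. -/
def IsMaxCliqueDs (n k : ℕ) (𝔖 : Set (Set (Submodule F (Fin n → F)))) : Prop :=
  IsCliqueDs F n k 𝔖 ∧ ∀ 𝔖', IsCliqueDs F n k 𝔖' → 𝔖 ⊆ 𝔖' → 𝔖' = 𝔖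

/-- A clique of the graph `Δ'_s`. -/
def IsCliqueDs' (n k : ℕ) (𝔖 : Set (Set (Submodule F (Fin n → F)))) : Prop :=
  (∀ S ∈ 𝔖, IsStarD F n k S) ∧ ∀ S ∈ 𝔖, ∀ S' ∈ 𝔖, S ≠ S' → AdjMC' F n k S S'

/-- A maximal clique of `Δ'_s`. -/
def IsMaxCliqueDs' (n k : ℕ) (𝔖 : Set (Set (Submodule F (Fin n → F)))) : Prop :=
  IsCliqueDs' F n k 𝔖 ∧ ∀ 𝔖', IsCliqueDs' F n k 𝔖' → 𝔖 ⊆ 𝔖' → 𝔖' = 𝔖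

/-- A special set of stars: a maximal clique in both `Δ_s` and `Δ'_s`. -/
def IsSpecialStars (n k : ℕ) (𝔖 : Set (Set (Submodule F (Fin n → F)))) : Prop :=
  IsMaxCliqueDs F n k 𝔖 ∧ IsMaxCliqueDs' F n k 𝔖

/-- A clique of the graph `Δ_t` (whose vertices are the tops of `Δ_k(V)`). -/
def IsCliqueDt (n k : ℕ) (𝔗 : Set (Set (Submodule F (Fin n → F)))) : Prop :=
  (∀ T ∈ 𝔗, IsTopD F n k T) ∧ ∀ T ∈ 𝔗, ∀ T' ∈ 𝔗, T ≠ T' → AdjMC F n k T T'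

/-- A maximal clique of `Δ_t`. -/
def IsMaxCliqueDt (n k : ℕ) (𝔗 : Set (Set (Submodule F (Fin n → F)))) : Prop :=
  IsCliqueDt F n k 𝔗 ∧ ∀ 𝔗', IsCliqueDt F n k 𝔗' → 𝔗 ⊆ 𝔗' → 𝔗' = 𝔗

/-- A clique of the graph `Δ'_t`. -/
def IsCliqueDt' (n k : ℕ) (𝔗 : Set (Set (Submodule F (Fin n → F)))) : Prop :=
  (∀ T ∈ 𝔗, IsTopD F n k T) ∧ ∀ T ∈ 𝔗, ∀ T' ∈ 𝔗, T ≠ T' → AdjMC' F n k T T'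

/-- A maximal clique of `Δ'_t`. -/
def IsMaxCliqueDt' (n k : ℕ) (𝔗 : Set (Set (Submodule F (Fin n → F)))) : Prop :=
  IsCliqueDt' F n k 𝔗 ∧ ∀ 𝔗', IsCliqueDt' F n k 𝔗' → 𝔗 ⊆ 𝔗' → 𝔗' = 𝔗

/-- A special set of tops: a maximal clique in both `Δ_t` and `Δ'_t`. -/
def IsSpecialTops (n k : ℕ) (𝔗 : Set (Set (Submodule F (Fin n → F)))) : Prop :=
  IsMaxCliqueDt F n k 𝔗 ∧ IsMaxCliqueDt' F n k 𝔗

/-- `𝔗_X`: the set of all `T^c(Y)` over non-degenerate `(k+1)`-dimensional `Y` containing `X`. -/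
def TopsThrough (n k : ℕ) (X : Submodule F (Fin n → F)) :
    Set (Set (Submodule F (Fin n → F))) :=
  {T | ∃ Y : Submodule F (Fin n → F),
    finrank F ↥Y = k + 1 ∧ IsNondeg F n Y ∧ X ≤ Y ∧ T = Tc F n k Y}

end Defs
section Dimension

variable {K V : Type*} [Field K] [AddCommGroup V] [Module K V] [FiniteDimensional K V]

lemma sup_eq_of_finrank_le_succ {P Q A : Submodule K V} (hP : P ≤ A) (hQ : Q ≤ A)
    (hd : finrank K A ≤ finrank K P + 1) (hQP : ¬ Q ≤ P) : P ⊔ Q = A := by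
  have h1 : P < P ⊔ Q := lt_of_le_of_ne le_sup_left fun h => hQP (h ▸ le_sup_right)
  have h2 := Submodule.finrank_lt_finrank_of_lt h1
  exact Submodule.eq_of_le_of_finrank_le (sup_le hP hQ) (by omega)

lemma finrank_inf_lt_of_ne {A B : Submodule K V} (h : finrank K A = finrank K B) (hne : A ≠ B) :
    finrank K ↥(A ⊓ B) < finrank K A := by
  refine Submodule.finrank_lt_finrank_of_lt (lt_of_le_of_ne inf_le_left fun he => hne ?_)
  exact Submodule.eq_of_le_of_finrank_le (inf_eq_left.mp he) h.ge

lemma finrank_sup_span_singleton_le (P : Submodule K V) (v : V) :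
    finrank K ↥(P ⊔ K ∙ v) ≤ finrank K P + 1 :=
  (Submodule.finrank_add_le_finrank_add_finrank P (K ∙ v)).trans
    (Nat.add_le_add_left ((finrank_span_le_card {v}).trans (by simp)) _)

lemma finrank_sup_span_singleton_of_notMem {P : Submodule K V} {v : V} (hv : v ∉ P) :
    finrank K ↥(P ⊔ K ∙ v) = finrank K P + 1 := by
  have h1 := finrank_sup_span_singleton_le P v
  have h2 : P < P ⊔ K ∙ v := lt_of_le_of_ne le_sup_left fun h =>
    hv (h ▸ (le_sup_right : K ∙ v ≤ _) (Submodule.mem_span_singleton_self v))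
  have h3 := Submodule.finrank_lt_finrank_of_lt h2
  omega

lemma exists_intermediate_finrank_eq {P Q : Submodule K V} (hPQ : P ≤ Q) {d : ℕ}
    (hP : finrank K P ≤ d) (hQ : d ≤ finrank K Q) :
    ∃ R : Submodule K V, P ≤ R ∧ R ≤ Q ∧ finrank K R = d := by
  induction d, hP using Nat.le_induction with
  | base => exact ⟨P, le_rfl, hPQ, rfl⟩
  | succ d _ ih =>
    obtain ⟨R, hPR, hRQ, hR⟩ := ih (by omega)
    obtain ⟨v, hvQ, hvR⟩ : ∃ v ∈ Q, v ∉ R := by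
      by_contra! h
      have := Submodule.finrank_mono (show Q ≤ R from h)
      omega
    refine ⟨R ⊔ K ∙ v, hPR.trans le_sup_left, sup_le hRQ ?_, ?_⟩
    · rwa [Submodule.span_singleton_le_iff_mem]
    · rw [finrank_sup_span_singleton_of_notMem hvR, hR]

/-- A clique of the Grassmann graph of `(d + 1)`-dimensional subspaces either lies below a
`(d + 2)`-dimensional subspace or above a `d`-dimensional one. -/
lemma grassmann_clique_le_or_ge {d : ℕ} (hd : d + 2 ≤ finrank K V) {C : Set (Submodule K V)}
    (hC : ∀ X ∈ C, finrank K X = d + 1)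
    (hadj : ∀ X ∈ C, ∀ X' ∈ C, X ≠ X' → finrank K ↥(X ⊓ X') = d) :
    (∃ Z : Submodule K V, finrank K Z = d + 2 ∧ ∀ X ∈ C, X ≤ Z) ∨
      ∃ Y : Submodule K V, finrank K Y = d ∧ ∀ X ∈ C, Y ≤ X := by
  by_cases hex : ∃ Z : Submodule K V, finrank K Z = d + 2 ∧ ∀ X ∈ C, X ≤ Z
  · exact Or.inl hex
  right
  push Not at hex
  have hstep : ∀ X₁ ∈ C, ∀ X₂ ∈ C, X₁ ≠ X₂ → ∀ X ∈ C, ¬ X ≤ X₁ ⊔ X₂ → X₁ ⊓ X₂ ≤ X := by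
    intro X₁ h₁ X₂ h₂ h12 X hX hXZ
    have hd1 := hadj X₁ h₁ X hX fun h => hXZ (h ▸ le_sup_left)
    have hd2 := hadj X₂ h₂ X hX fun h => hXZ (h ▸ le_sup_right)
    have hle : X₂ ⊓ X ≤ X₁ ⊓ X := by
      by_contra hcon
      have := sup_eq_of_finrank_le_succ (A := X) inf_le_right inf_le_right
        (by rw [hC X hX, hd1]) hcon
      exact hXZ (this ▸ sup_le_sup inf_le_left inf_le_left)
    have heq : X₂ ⊓ X = X₁ ⊓ X₂ := Submodule.eq_of_le_of_finrank_eq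
      (le_inf (hle.trans inf_le_left) inf_le_left) (by rw [hd2, hadj X₁ h₁ X₂ h₂ h12])
    exact heq ▸ inf_le_right
  obtain ⟨Z₀, -, -, hZ₀⟩ := exists_intermediate_finrank_eq (K := K) (V := V)
    (P := ⊥) (Q := ⊤) bot_le (d := d + 2) (by simp) (by simpa using hd)
  obtain ⟨X₁, h₁, -⟩ := hex Z₀ hZ₀
  obtain ⟨Z₁, hXZ₁, -, hZ₁⟩ := exists_intermediate_finrank_eq (le_top : X₁ ≤ ⊤) (d := d + 2)
    (by rw [hC X₁ h₁]; omega) (by simpa using hd)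
  obtain ⟨X₂, h₂, hX₂⟩ := hex Z₁ hZ₁
  have h12 : X₁ ≠ X₂ := fun h => hX₂ (h ▸ hXZ₁)
  have hI := hadj X₁ h₁ X₂ h₂ h12
  have hsum := Submodule.finrank_sup_add_finrank_inf_eq X₁ X₂
  rw [hC X₁ h₁, hC X₂ h₂, hI] at hsum
  obtain ⟨X₃, h₃, hX₃⟩ := hex (X₁ ⊔ X₂) (by omega)
  have hY3 := hstep X₁ h₁ X₂ h₂ h12 X₃ h₃ hX₃
  refine ⟨X₁ ⊓ X₂, hI, fun X hX => ?_⟩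
  by_contra hcon
  have hle12 : X ≤ X₁ ⊔ X₂ := by
    by_contra h
    exact hcon (hstep X₁ h₁ X₂ h₂ h12 X hX h)
  have h13 : X₁ ≠ X₃ := fun h => hX₃ (h ▸ le_sup_left)
  have heq13 : X₁ ⊓ X₂ = X₁ ⊓ X₃ := Submodule.eq_of_le_of_finrank_eq
    (le_inf inf_le_left hY3) (by rw [hI, hadj X₁ h₁ X₃ h₃ h13])
  have hle13 : X ≤ X₁ ⊔ X₃ := by
    by_contra h
    exact hcon (heq13 ▸ hstep X₁ h₁ X₃ h₃ h13 X hX h)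
  have hsum13 := Submodule.finrank_sup_add_finrank_inf_eq X₁ X₃
  rw [hC X₁ h₁, hC X₃ h₃, hadj X₁ h₁ X₃ h₃ h13] at hsum13
  have hlt : finrank K ↥((X₁ ⊔ X₃) ⊓ (X₁ ⊔ X₂)) < finrank K ↥(X₁ ⊔ X₃) :=
    finrank_inf_lt_of_ne (by omega) fun h => hX₃ (h ▸ le_sup_right)
  have hX₁ : X₁ = (X₁ ⊔ X₃) ⊓ (X₁ ⊔ X₂) := Submodule.eq_of_le_of_finrank_le
    (le_inf le_sup_left le_sup_left) (by rw [hC X₁ h₁]; omega)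
  have hXX₁ : X ≤ X₁ := hX₁ ▸ le_inf hle13 hle12
  have := Submodule.eq_of_le_of_finrank_eq hXX₁ (by rw [hC X hX, hC X₁ h₁])
  exact hcon (this ▸ inf_le_left)

end Dimension

section Stars

variable {F : Type*} [Field F] {n k : ℕ}

lemma mem_coordHyp {i : Fin n} {v : Fin n → F} : v ∈ coordHyp F n i ↔ v i = 0 := by
  simp [coordHyp]

lemma isNondeg_of_mem {W : Submodule F (Fin n → F)} {v : Fin n → F} (hv : v ∈ W)
    (h : ∀ i, v i ≠ 0) : IsNondeg F n W :=
  fun ⟨i, hi⟩ => h i (mem_coordHyp.mp (hi hv))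

lemma exists_notMem_of_card_lt_mk {α : Type*} {N : ℕ} (hN : (N : Cardinal) < Cardinal.mk α)
    (s : Finset α) (hs : s.card ≤ N) : ∃ c, c ∉ s := by
  by_contra! h
  have h1 : (s : Set α) = Set.univ := Set.eq_univ_of_forall h
  have h2 : Cardinal.mk α = s.card := by
    rw [← Cardinal.mk_univ, ← h1]
    exact Cardinal.mk_coe_finset
  rw [h2, Nat.cast_lt] at hN
  omega

lemma exists_notMem_forall_ne_zero {c : F} (hc0 : c ≠ 0) (hc1 : c ≠ 1)
    {H : Submodule F (Fin n → F)} (hH : H ≠ ⊤) :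
    ∃ v : Fin n → F, v ∉ H ∧ ∀ i, v i ≠ 0 := by
  by_contra! h
  have key : ∀ v : Fin n → F, (∀ i, v i ≠ 0) → v ∈ H := fun v hv => by
    by_contra hvH
    obtain ⟨i, hi⟩ := h v hvH
    exact hv i hi
  apply hH
  rw [eq_top_iff, ← (Pi.basisFun F (Fin n)).span_eq, Submodule.span_le]
  rintro _ ⟨i, rfl⟩
  have h1 : (1 : Fin n → F) ∈ H := key _ fun _ => one_ne_zero
  have h2 : Function.update (1 : Fin n → F) i c ∈ H := key _ fun j => by
    by_cases hj : j = i
    · subst hj; simpa using hc0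
    · simp [hj]
  have h3 := H.smul_mem (c - 1)⁻¹ (H.sub_mem h2 h1)
  have hc : c - 1 ≠ 0 := sub_ne_zero.mpr hc1
  suffices he : Pi.basisFun F (Fin n) i =
      (c - 1)⁻¹ • (Function.update (1 : Fin n → F) i c - 1) from he ▸ h3
  ext j
  by_cases hj : j = i
  · subst hj; simp [hc]
  · simp [hj]

lemma card_add_finrank_le_of_le_coordHyp
    (X : Submodule F (Fin n → F)) (s : Finset (Fin n)) (hs : ∀ i ∈ s, X ≤ coordHyp F n i) :
    s.card + finrank F X ≤ n := by
  let f : (Fin n → F) →ₗ[F] (s → F) := LinearMap.funLeft F F (Subtype.val : s → Fin n)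
  have hsurj : Function.Surjective f :=
    LinearMap.funLeft_surjective_of_injective F F _ Subtype.val_injective
  have h1 := f.finrank_range_add_finrank_ker
  rw [LinearMap.range_eq_top.mpr hsurj, finrank_top] at h1
  simp only [finrank_fintype_fun_eq_card, Fintype.card_coe, Fintype.card_fin] at h1
  have h2 : X ≤ LinearMap.ker f := fun x hx => by
    rw [LinearMap.mem_ker]
    ext i
    exact mem_coordHyp.mp (hs i i.2 hx)
  have := Submodule.finrank_mono h2
  omega

lemma exists_mem_Sc_not_le (hk : 1 < k) (hkn : k < n - 1)
    (hF : (↑(n - k) : Cardinal) < Cardinal.mk F) {X H : Submodule F (Fin n → F)}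
    (hX : finrank F X = k - 1) (hXH : X ≤ H) (hH : H ≠ ⊤) :
    ∃ A ∈ Sc F n k X, ¬ A ≤ H := by
  classical
  obtain ⟨c, hc⟩ := exists_notMem_of_card_lt_mk hF {0, 1} (Finset.card_le_two.trans (by omega))
  simp only [Finset.mem_insert, Finset.mem_singleton, not_or] at hc
  obtain ⟨v, hvH, hv⟩ := exists_notMem_forall_ne_zero hc.1 hc.2 hH
  have hvA : v ∈ X ⊔ F ∙ v := (le_sup_right : F ∙ v ≤ _) (Submodule.mem_span_singleton_self v)
  refine ⟨X ⊔ F ∙ v, ⟨?_, le_sup_left, isNondeg_of_mem hvA hv⟩, fun h => hvH (h hvA)⟩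
  rw [finrank_sup_span_singleton_of_notMem fun h => hvH (hXH h)]
  omega

lemma ne_top_of_finrank_le (hkn : k < n - 1) {H : Submodule F (Fin n → F)}
    (hH : finrank F H ≤ k + 1) : H ≠ ⊤ := by
  rintro rfl
  rw [finrank_top, finrank_fintype_fun_eq_card, Fintype.card_fin] at hH
  omega

lemma Sc_injective (hk : 1 < k) (hkn : k < n - 1) (hF : (↑(n - k) : Cardinal) < Cardinal.mk F)
    {X₁ X₂ : Submodule F (Fin n → F)} (h₁ : finrank F X₁ = k - 1) (h₂ : finrank F X₂ = k - 1)
    (h : Sc F n k X₁ = Sc F n k X₂) : X₁ = X₂ := by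
  by_contra hne
  obtain ⟨A, hA, -⟩ := exists_mem_Sc_not_le hk hkn hF h₁ le_rfl
    (ne_top_of_finrank_le hkn (by omega))
  obtain ⟨B, hB, hBA⟩ := exists_mem_Sc_not_le hk hkn hF h₁ hA.2.1
    (ne_top_of_finrank_le hkn (by rw [hA.1]; omega))
  have hA₂ := h ▸ hA
  have hB₂ := h ▸ hB
  have hle : X₁ ⊔ X₂ ≤ A ⊓ B := le_inf (sup_le hA.2.1 hA₂.2.1) (sup_le hB.2.1 hB₂.2.1)
  have h3 := Submodule.finrank_mono hle
  have h4 := finrank_inf_lt_of_ne (hA.1.trans hB.1.symm) fun h => hBA h.ge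
  have h5 := finrank_inf_lt_of_ne (h₁.trans h₂.symm) hne
  have h6 := Submodule.finrank_sup_add_finrank_inf_eq X₁ X₂
  rw [hA.1] at h4
  omega

lemma isStarD_Sc (hk : 1 < k) (hkn : k < n - 1) (hF : (↑(n - k) : Cardinal) < Cardinal.mk F)
    {X : Submodule F (Fin n → F)} (hX : finrank F X = k - 1) : IsStarD F n k (Sc F n k X) := by
  refine ⟨⟨X, hX, rfl⟩, ⟨fun A hA => ⟨hA.1, hA.2.2⟩, fun A hA B hB hne => ⟨hne, ?_⟩⟩, ?_⟩
  · have h1 := Submodule.finrank_mono (le_inf hA.2.1 hB.2.1)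
    have h2 := finrank_inf_lt_of_ne (hA.1.trans hB.1.symm) hne
    rw [hA.1] at h2
    omega
  · intro D hD hsub
    refine Set.Subset.antisymm (fun B hB => ⟨(hD.1 B hB).1, ?_, (hD.1 B hB).2⟩) hsub
    by_contra hXB
    have hBk := (hD.1 B hB).1
    have hadj : ∀ A ∈ Sc F n k X, finrank F ↥(A ⊓ B) = k - 1 := fun A hA =>
      (hD.2 A (hsub hA) B hB fun h => hXB (h ▸ hA.2.1)).2
    obtain ⟨A, hA, -⟩ := exists_mem_Sc_not_le hk hkn hF hX le_rfl
      (ne_top_of_finrank_le hkn (by omega))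
    have h1 := Submodule.finrank_sup_add_finrank_inf_eq A B
    rw [hadj A hA, hA.1, hBk] at h1
    obtain ⟨A', hA', hle⟩ := exists_mem_Sc_not_le hk hkn hF hX (hA.2.1.trans le_sup_left)
      (ne_top_of_finrank_le (H := A ⊔ B) hkn (by omega))
    apply hle
    have h2 : ¬ A' ⊓ B ≤ X := fun h => hXB <|
      (Submodule.eq_of_le_of_finrank_eq h (by rw [hadj A' hA', hX])) ▸ inf_le_right
    rw [← sup_eq_of_finrank_le_succ hA'.2.1 inf_le_left (by rw [hA'.1]; omega) h2]
    exact sup_le_sup hA.2.1 inf_le_right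

lemma exists_mem_Sc_adjK (hk : 1 < k) (hkn : k < n - 1)
    (hF : (↑(n - k) : Cardinal) < Cardinal.mk F)
    {X₁ X₂ : Submodule F (Fin n → F)} (h₂ : finrank F X₂ = k - 1)
    (h12 : finrank F ↥(X₁ ⊓ X₂) = k - 2) {A : Submodule F (Fin n → F)} (hA : A ∈ Sc F n k X₁) :
    ∃ B ∈ Sc F n k X₂, AdjK F n k A B := by
  classical
  obtain ⟨hAk, hXA, hnd⟩ := hA
  by_cases hX₂A : X₂ ≤ A
  · obtain ⟨B, hB, hBA⟩ := exists_mem_Sc_not_le hk hkn hF h₂ hX₂A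
      (ne_top_of_finrank_le hkn (by omega))
    have hne : A ≠ B := fun h => hBA h.ge
    have h1 := Submodule.finrank_mono (le_inf hX₂A hB.2.1)
    have h2 := finrank_inf_lt_of_ne (hAk.trans hB.1.symm) hne
    exact ⟨B, hB, hne, by omega⟩
  have hlt : A ⊓ X₂ < X₂ := lt_of_le_of_ne inf_le_right fun h => hX₂A (h ▸ inf_le_left)
  have hD : finrank F ↥(A ⊓ X₂) = k - 2 := by
    have h1 := Submodule.finrank_lt_finrank_of_lt hlt
    have h2 := Submodule.finrank_mono (inf_le_inf_right X₂ hXA)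
    omega
  obtain ⟨a, haA, haX, ha⟩ : ∃ a ∈ A, a ∉ X₂ ∧ ∀ i, X₂ ≤ coordHyp F n i → a i ≠ 0 := by
    by_cases hZ : ∃ i₀, X₂ ≤ coordHyp F n i₀
    · obtain ⟨i₀, hi₀⟩ := hZ
      obtain ⟨a, haA, ha⟩ : ∃ a ∈ A, a i₀ ≠ 0 := by
        by_contra! h
        exact hnd ⟨i₀, fun a ha => mem_coordHyp.mpr (h a ha)⟩
      obtain ⟨b, hbA, hbD, hb⟩ : ∃ b ∈ A, b ∉ A ⊓ X₂ ∧ b i₀ = 0 := by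
        by_contra! h
        have hle : A ⊓ coordHyp F n i₀ ≤ A ⊓ X₂ := fun b hb => by
          by_contra hbD
          exact h b hb.1 hbD (mem_coordHyp.mp hb.2)
        have h1 := Submodule.finrank_mono hle
        have h2 := Submodule.finrank_sup_add_finrank_inf_eq A (coordHyp F n i₀)
        have h3 := Submodule.finrank_le (A ⊔ coordHyp F n i₀)
        have h4 : n ≤ finrank F (coordHyp F n i₀) + 1 := by
          have h5 := (LinearMap.proj (R := F) (φ := fun _ : Fin n => F)
            i₀).finrank_range_add_finrank_ker
          have h6 := Submodule.finrank_le
            (LinearMap.range (LinearMap.proj (R := F) (φ := fun _ : Fin n => F) i₀))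
          simp only [finrank_fintype_fun_eq_card, Fintype.card_fin, finrank_self] at h5 h6
          rw [coordHyp]
          omega
        simp only [finrank_fintype_fun_eq_card, Fintype.card_fin] at h3
        omega
      let Z : Finset (Fin n) := Finset.univ.filter fun i => X₂ ≤ coordHyp F n i
      have hZc := card_add_finrank_le_of_le_coordHyp X₂ Z (by simp [Z])
      have hi₀Z : i₀ ∈ Z := by simp [Z, hi₀]
      obtain ⟨t, ht⟩ := exists_notMem_of_card_lt_mk hF
        ((Z.erase i₀).image fun i => - a i / b i)
        (Finset.card_image_le.trans (by rw [Finset.card_erase_of_mem hi₀Z]; omega))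
      have hne : (a + t • b) i₀ ≠ 0 := by simpa [hb] using ha
      refine ⟨a + t • b, A.add_mem haA (A.smul_mem t hbA),
        fun h => hne (mem_coordHyp.mp (hi₀ h)), fun i hi h0 => ?_⟩
      by_cases hbi : b i = 0
      · have hai : a i = 0 := by simpa [hbi] using h0
        have hDb : (A ⊓ X₂) ⊔ F ∙ b ≤ coordHyp F n i₀ := sup_le (inf_le_right.trans hi₀)
          ((Submodule.span_singleton_le_iff_mem _ _).mpr (mem_coordHyp.mpr hb))
        have hA : (A ⊓ X₂) ⊔ F ∙ b ⊔ F ∙ a = A := by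
          refine Submodule.eq_of_le_of_finrank_le (sup_le (sup_le inf_le_left ?_) ?_) ?_
          · rwa [Submodule.span_singleton_le_iff_mem]
          · rwa [Submodule.span_singleton_le_iff_mem]
          · rw [finrank_sup_span_singleton_of_notMem fun h => ha (mem_coordHyp.mp (hDb h)),
              finrank_sup_span_singleton_of_notMem hbD]
            omega
        refine hnd ⟨i, hA ▸ sup_le (sup_le (inf_le_right.trans hi) ?_) ?_⟩
        · rwa [Submodule.span_singleton_le_iff_mem, mem_coordHyp]
        · rwa [Submodule.span_singleton_le_iff_mem, mem_coordHyp]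
      · refine ht (Finset.mem_image.mpr ⟨i, Finset.mem_erase.mpr ⟨?_, by simp [Z, hi]⟩, ?_⟩)
        · rintro rfl
          exact hbi hb
        · rw [div_eq_iff hbi]
          simp only [Pi.add_apply, Pi.smul_apply, smul_eq_mul] at h0
          linear_combination -h0
    · push Not at hZ
      obtain ⟨a, haA, ha⟩ : ∃ a ∈ A, a ∉ X₂ := by
        by_contra! h
        have := Submodule.finrank_mono (show A ≤ X₂ from h)
        omega
      exact ⟨a, haA, ha, fun i hi => (hZ i hi).elim⟩
  have haB : a ∈ X₂ ⊔ F ∙ a := (le_sup_right : F ∙ a ≤ _) (Submodule.mem_span_singleton_self a)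
  have hBk : finrank F ↥(X₂ ⊔ F ∙ a) = k := by
    rw [finrank_sup_span_singleton_of_notMem haX]
    omega
  refine ⟨X₂ ⊔ F ∙ a, ⟨hBk, le_sup_left, fun ⟨i, hi⟩ =>
    ha i (le_sup_left.trans hi) (mem_coordHyp.mp (hi haB))⟩, ?_⟩
  have hne : A ≠ X₂ ⊔ F ∙ a := fun h => hX₂A (h ▸ le_sup_left)
  have h1 := finrank_inf_lt_of_ne (hAk.trans hBk.symm) hne
  have h2 : (A ⊓ X₂) ⊔ F ∙ a ≤ A ⊓ (X₂ ⊔ F ∙ a) :=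
    sup_le (inf_le_inf_left A le_sup_left)
      ((Submodule.span_singleton_le_iff_mem _ _).mpr ⟨haA, haB⟩)
  have h3 := Submodule.finrank_mono h2
  rw [finrank_sup_span_singleton_of_notMem fun h : a ∈ A ⊓ X₂ => haX h.2] at h3
  exact ⟨hne, by omega⟩

lemma adjMC_Sc_iff (hk : 1 < k) (hkn : k < n - 1) (hF : (↑(n - k) : Cardinal) < Cardinal.mk F)
    {X₁ X₂ : Submodule F (Fin n → F)} (h₁ : finrank F X₁ = k - 1) (h₂ : finrank F X₂ = k - 1)
    (hne : X₁ ≠ X₂) :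
    AdjMC F n k (Sc F n k X₁) (Sc F n k X₂) ↔ finrank F ↥(X₁ ⊓ X₂) = k - 2 := by
  constructor
  · rintro ⟨-, h, -⟩
    have hdim : ∀ A ∈ Sc F n k X₁, k - 2 ≤ finrank F ↥(A ⊓ X₂) := by
      intro A hA
      obtain ⟨B, hB, -, hAB⟩ := h A hA
      have e1 := Submodule.finrank_sup_add_finrank_inf_eq (A ⊓ B) X₂
      have e2 := Submodule.finrank_mono (sup_le inf_le_right hB.2.1 : A ⊓ B ⊔ X₂ ≤ B)
      have e3 := Submodule.finrank_mono (inf_le_inf_right X₂ inf_le_left : A ⊓ B ⊓ X₂ ≤ A ⊓ X₂)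
      have e4 := hB.1
      omega
    have hlt := finrank_inf_lt_of_ne (h₁.trans h₂.symm) hne
    by_contra hcon
    obtain ⟨A, hA, -⟩ := exists_mem_Sc_not_le hk hkn hF h₁ le_rfl
      (ne_top_of_finrank_le hkn (by omega))
    have hd := hdim A hA
    have e1 := Submodule.finrank_sup_add_finrank_inf_eq (A ⊓ X₂) X₁
    have e2 := Submodule.finrank_mono (sup_le inf_le_left hA.2.1 : A ⊓ X₂ ⊔ X₁ ≤ A)
    have e3 := Submodule.finrank_mono
      (le_inf inf_le_right (inf_le_left.trans inf_le_right) : A ⊓ X₂ ⊓ X₁ ≤ X₁ ⊓ X₂)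
    have e4 := Submodule.finrank_sup_add_finrank_inf_eq X₁ X₂
    have e5 := hA.1
    obtain ⟨A', hA', hle⟩ := exists_mem_Sc_not_le hk hkn hF h₁ (le_sup_left : X₁ ≤ X₁ ⊔ X₂)
      (ne_top_of_finrank_le hkn (by omega))
    have hd' := hdim A' hA'
    have hn : ¬ A' ⊓ X₂ ≤ X₁ := fun hc => by
      have := Submodule.finrank_mono (le_inf hc inf_le_right : A' ⊓ X₂ ≤ X₁ ⊓ X₂)
      omega
    apply hle
    rw [← sup_eq_of_finrank_le_succ hA'.2.1 inf_le_left (by rw [hA'.1]; omega) hn]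
    exact sup_le_sup_left inf_le_right _
  · intro h
    exact ⟨fun he => hne (Sc_injective hk hkn hF h₁ h₂ he),
      fun A hA => exists_mem_Sc_adjK hk hkn hF h₂ h hA,
      fun A hA => exists_mem_Sc_adjK hk hkn hF h₁ (by rwa [inf_comm]) hA⟩

lemma Sc_mem_of_forall_finrank_inf (hk : 1 < k) (hkn : k < n - 1)
    (hF : (↑(n - k) : Cardinal) < Cardinal.mk F) {𝔖 : Set (Set (Submodule F (Fin n → F)))}
    (h𝔖 : IsMaxCliqueDs F n k 𝔖) {X : Submodule F (Fin n → F)} (hX : finrank F X = k - 1)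
    (h : ∀ X' : Submodule F (Fin n → F), finrank F X' = k - 1 → Sc F n k X' ∈ 𝔖 → X' ≠ X →
      finrank F ↥(X' ⊓ X) = k - 2) : Sc F n k X ∈ 𝔖 := by
  have key : ∀ S ∈ 𝔖, S ≠ Sc F n k X → AdjMC F n k S (Sc F n k X) := by
    intro S hS hne
    obtain ⟨⟨X', hX', rfl⟩, -⟩ := h𝔖.1.1 S hS
    have hne' : X' ≠ X := fun he => hne (he ▸ rfl)
    exact (adjMC_Sc_iff hk hkn hF hX' hX hne').mpr (h X' hX' hS hne')
  have hins : IsCliqueDs F n k (insert (Sc F n k X) 𝔖) := by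
    constructor
    · rintro S (rfl | hS)
      · exact isStarD_Sc hk hkn hF hX
      · exact h𝔖.1.1 S hS
    · rintro S (rfl | hS) S' (rfl | hS') hne
      · exact (hne rfl).elim
      · obtain ⟨-, ha, hb⟩ := key S' hS' hne.symm
        exact ⟨hne, hb, ha⟩
      · exact key S hS hne
      · exact h𝔖.1.2 S hS S' hS' hne
  exact h𝔖.2 _ hins (Set.subset_insert _ _) ▸ Set.mem_insert _ _

end Stars

/-- for `|F| > n - k` and `k ≥ 3`, every special set of stars is the set
of all stars `S^c(X')` with `X'` a `(k-1)`-dimensional subspace of a fixed degenerate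
`k`-dimensional subspace `X`. -/
theorem stmt10 (F : Type*) [Field F] (n k : ℕ)
    (hk1 : 1 < k) (hk2 : k < n - 1) (hk3 : 3 ≤ k)
    (hF : (↑(n - k) : Cardinal) < Cardinal.mk F)
    (𝔖 : Set (Set (Submodule F (Fin n → F)))) (h𝔖 : IsSpecialStars F n k 𝔖) :
    ∃ X : Submodule F (Fin n → F), finrank F ↥X = k ∧ IsDeg F n X ∧
      𝔖 = {S | ∃ X' : Submodule F (Fin n → F),
        finrank F ↥X' = k - 1 ∧ X' ≤ X ∧ S = Sc F n k X'} := by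
  have hdimV : finrank F (Fin n → F) = n := by simp
  have hadj : ∀ X X' : Submodule F (Fin n → F), finrank F X = k - 1 → finrank F X' = k - 1 →
      Sc F n k X ∈ 𝔖 → Sc F n k X' ∈ 𝔖 → X ≠ X' → finrank F ↥(X ⊓ X') = k - 2 :=
    fun X X' hX hX' hS hS' hne => (adjMC_Sc_iff hk1 hk2 hF hX hX' hne).mp
      (h𝔖.1.1.2 _ hS _ hS' fun h => hne (Sc_injective hk1 hk2 hF hX hX' h))
  have hdeg : ∀ X X' A : Submodule F (Fin n → F), finrank F X = k - 1 → finrank F X' = k - 1 →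
      Sc F n k X ∈ 𝔖 → Sc F n k X' ∈ 𝔖 → X ≠ X' → finrank F A = k → X ≤ A → X' ≤ A →
      IsDeg F n A := by
    intro X X' A hX hX' hS hS' hne hA hXA hXA'
    by_contra hnd
    have := (h𝔖.2.1.2 _ hS _ hS' fun h => hne (Sc_injective hk1 hk2 hF hX hX' h)).2
    exact this.subset ⟨⟨hA, hXA, hnd⟩, ⟨hA, hXA', hnd⟩⟩
  have hpair : ∀ Y A : Submodule F (Fin n → F), finrank F Y = k - 2 → finrank F A = k → Y ≤ A →
      ∃ X X' : Submodule F (Fin n → F), finrank F X = k - 1 ∧ finrank F X' = k - 1 ∧ X ≠ X' ∧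
        Y ≤ X ∧ Y ≤ X' ∧ X ≤ A ∧ X' ≤ A := by
    intro Y A hY hA hYA
    obtain ⟨X, hYX, hXA, hX⟩ := exists_intermediate_finrank_eq hYA (d := k - 1)
      (by omega) (by omega)
    obtain ⟨v, hvA, hvX⟩ : ∃ v ∈ A, v ∉ X := by
      by_contra! h
      have := Submodule.finrank_mono (show A ≤ X from h)
      omega
    refine ⟨X, Y ⊔ F ∙ v, hX, ?_, fun h => hvX ?_, hYX, le_sup_left, hXA,
      sup_le hYA ((Submodule.span_singleton_le_iff_mem _ _).mpr hvA)⟩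
    · rw [finrank_sup_span_singleton_of_notMem fun h => hvX (hYX h)]
      omega
    · exact h ▸ (le_sup_right : F ∙ v ≤ _) (Submodule.mem_span_singleton_self v)
  rcases grassmann_clique_le_or_ge (d := k - 2) (by omega)
    (C := {X : Submodule F (Fin n → F) | finrank F X = k - 1 ∧ Sc F n k X ∈ 𝔖})
    (fun X hX => by rw [hX.1]; omega)
    (fun X hX X' hX' hne => hadj X X' hX.1 hX'.1 hX.2 hX'.2 hne) with
    ⟨Z, hZ, hZle⟩ | ⟨Y, hY, hYle⟩
  · have hZk : finrank F Z = k := by omega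
    have hmem : ∀ X : Submodule F (Fin n → F), finrank F X = k - 1 → X ≤ Z → Sc F n k X ∈ 𝔖 := by
      intro X hX hXZ
      refine Sc_mem_of_forall_finrank_inf hk1 hk2 hF h𝔖.1 hX fun X' hX' hS hne => ?_
      have h1 := Submodule.finrank_sup_add_finrank_inf_eq X' X
      have h2 := Submodule.finrank_mono (sup_le (hZle X' ⟨hX', hS⟩) hXZ)
      have h3 := finrank_inf_lt_of_ne (hX'.trans hX.symm) hne
      omega
    refine ⟨Z, hZk, ?_, ?_⟩
    · obtain ⟨Y, -, hYZ, hY⟩ := exists_intermediate_finrank_eq (bot_le : ⊥ ≤ Z) (d := k - 2)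
        (by simp) (by omega)
      obtain ⟨X, X', hX, hX', hne, -, -, hXZ, hXZ'⟩ := hpair Y Z hY hZk hYZ
      exact hdeg X X' Z hX hX' (hmem X hX hXZ) (hmem X' hX' hXZ') hne hZk hXZ hXZ'
    · ext S
      constructor
      · intro hS
        obtain ⟨⟨X, hX, rfl⟩, -⟩ := h𝔖.1.1.1 S hS
        exact ⟨X, hX, hZle X ⟨hX, hS⟩, rfl⟩
      · rintro ⟨X, hX, hXZ, rfl⟩
        exact hmem X hX hXZ
  · exfalso
    have hmem : ∀ X : Submodule F (Fin n → F), finrank F X = k - 1 → Y ≤ X → Sc F n k X ∈ 𝔖 := by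
      intro X hX hYX
      refine Sc_mem_of_forall_finrank_inf hk1 hk2 hF h𝔖.1 hX fun X' hX' hS hne => ?_
      have h1 := Submodule.finrank_mono (le_inf (hYle X' ⟨hX', hS⟩) hYX)
      have h2 := finrank_inf_lt_of_ne (hX'.trans hX.symm) hne
      omega
    have hle := finrank_sup_span_singleton_le Y (1 : Fin n → F)
    obtain ⟨A, hYA, -, hA⟩ := exists_intermediate_finrank_eq
      (le_top : Y ⊔ F ∙ (1 : Fin n → F) ≤ ⊤) (d := k) (by omega)
      (by rw [finrank_top, hdimV]; omega)
    obtain ⟨X, X', hX, hX', hne, hYX, hYX', hXA, hXA'⟩ :=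
      hpair Y A hY hA (le_sup_left.trans hYA)
    exact isNondeg_of_mem
      (hYA ((le_sup_right : F ∙ _ ≤ _) (Submodule.mem_span_singleton_self (1 : Fin n → F))))
      (fun _ => one_ne_zero)
      (hdeg X X' A hX hX' (hmem X hX hYX) (hmem X' hX' hYX') hne hA hXA hXA')
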